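/- Let a, n, l be positive integers, Z₀ ∈ ℝ^{a×l}, X ∈ ℝ^{n×l}, let T be a linear subspace of ℝ^{a×n}, and let Λ̄ be the cosupport of Z₀. Define g(Δ) := ‖Z₀ + ΔX‖₁. Then Δ = 0 is the unique minimizer of g over T if and only if for every nonzero Δ ∈ T one has ⟨ΔX, sgn(Z₀)⟩ + ‖(ΔX)_Λ̄‖₁ > 0. -/

import Mathlib

open scoped BigOperators Classical
open Matrix

/-- Entrywise ℓ1 norm of a real matrix. -/
noncomputable def l1 {m n : ℕ} (A : Matrix (Fin m) (Fin n) ℝ) : ℝ :=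
  ∑ i, ∑ j, |A i j|

/-- Frobenius norm of a real matrix. -/
noncomputable def frob {m n : ℕ} (A : Matrix (Fin m) (Fin n) ℝ) : ℝ :=
  Real.sqrt (∑ i, ∑ j, (A i j) ^ 2)

/-- Frobenius inner product ⟨A,B⟩ = tr(AᵀB). -/
noncomputable def finner {m n : ℕ} (A B : Matrix (Fin m) (Fin n) ℝ) : ℝ :=
  ∑ i, ∑ j, A i j * B i j

/-- Entrywise sign matrix (with sgn 0 = 0). -/
noncomputable def msgn {m n : ℕ} (A : Matrix (Fin m) (Fin n) ℝ) : Matrix (Fin m) (Fin n) ℝ :=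
  fun i j => Real.sign (A i j)

/-- Restriction A_Λ of a matrix to an index set Λ (zero outside Λ). -/
noncomputable def restrict {m n : ℕ} (A : Matrix (Fin m) (Fin n) ℝ)
    (Λ : Set (Fin m × Fin n)) : Matrix (Fin m) (Fin n) ℝ :=
  fun i j => if (i, j) ∈ Λ then A i j else 0

/-- Support of a matrix. -/
def suppSet {m n : ℕ} (M : Matrix (Fin m) (Fin n) ℝ) : Set (Fin m × Fin n) :=
  {p | M p.1 p.2 ≠ 0}

/-- Cosupport of a matrix. -/
def cosuppSet {m n : ℕ} (M : Matrix (Fin m) (Fin n) ℝ) : Set (Fin m × Fin n) :=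
  {p | M p.1 p.2 = 0}

/-- Euclidean norm of the i-th row of a matrix. -/
noncomputable def rowNorm {m n : ℕ} (A : Matrix (Fin m) (Fin n) ℝ) (i : Fin m) : ℝ :=
  Real.sqrt (∑ j, (A i j) ^ 2)

/-- Uniformly normalised tight frames with row norm c. -/
def untf (m n : ℕ) (c : ℝ) : Set (Matrix (Fin m) (Fin n) ℝ) :=
  {Ω | Ωᵀ * Ω = 1 ∧ ∀ i, rowNorm Ω i = c}

/-- Tangent space T_C(Ω₀) of the UNTF constraint set at Ω₀. -/
def tangentC {m n : ℕ} (Ω₀ : Matrix (Fin m) (Fin n) ℝ) : Set (Matrix (Fin m) (Fin n) ℝ) :=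
  {Δ | Δᵀ * Ω₀ + Ω₀ᵀ * Δ = 0 ∧ ∀ i, ∑ j, Ω₀ i j * Δ i j = 0}

/-- The linearised objective L_λ(Δ, Σ). -/
noncomputable def Lfun {a n l : ℕ} (Ω₀ : Matrix (Fin a) (Fin n) ℝ)
    (X₀ Y : Matrix (Fin n) (Fin l) ℝ) (lam : ℝ)
    (Δ : Matrix (Fin a) (Fin n) ℝ) (S : Matrix (Fin n) (Fin l) ℝ) : ℝ :=
  l1 (Ω₀ * X₀ + Δ * X₀ + Ω₀ * S) + lam * Matrix.trace (Sᵀ * (X₀ - Y))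

lemma entry_le (z d : ℝ) :
    |z| + (d * Real.sign z + |if z = 0 then d else 0|) ≤ |z + d| := by
  rcases lt_trichotomy z 0 with h | h | h
  · rw [Real.sign_of_neg h, if_neg h.ne, abs_of_neg h]
    have := neg_le_abs (z + d)
    simp; linarith
  · subst h; simp
  · rw [Real.sign_of_pos h, if_neg h.ne', abs_of_pos h]
    have := le_abs_self (z + d)
    simp; linarith

lemma entry_eq (z d : ℝ) (hd : z ≠ 0 → |d| ≤ |z|) :
    |z + d| = |z| + (d * Real.sign z + |if z = 0 then d else 0|) := by
  rcases lt_trichotomy z 0 with h | h | h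
  · have h1 := hd h.ne
    rw [abs_of_neg h] at h1
    have := abs_le.1 h1
    rw [Real.sign_of_neg h, if_neg h.ne, abs_of_neg h, abs_of_nonpos (by linarith)]
    simp; ring
  · subst h; simp
  · have h1 := hd h.ne'
    rw [abs_of_pos h] at h1
    have := abs_le.1 h1
    rw [Real.sign_of_pos h, if_neg h.ne', abs_of_pos h, abs_of_nonneg (by linarith)]
    simp

lemma sum_form {a l : ℕ} (Z D : Matrix (Fin a) (Fin l) ℝ) :
    l1 Z + (finner D (msgn Z) + l1 (restrict D (cosuppSet Z))) =
      ∑ i, ∑ j, (|Z i j| + (D i j * Real.sign (Z i j) + |if Z i j = 0 then D i j else 0|)) := by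
  simp only [Finset.sum_add_distrib, l1, finner, msgn, restrict, cosuppSet, Set.mem_setOf_eq]

lemma l1_ge {a l : ℕ} (Z D : Matrix (Fin a) (Fin l) ℝ) :
    l1 Z + (finner D (msgn Z) + l1 (restrict D (cosuppSet Z))) ≤ l1 (Z + D) := by
  rw [sum_form]
  exact Finset.sum_le_sum fun i _ => Finset.sum_le_sum fun j _ => entry_le _ _

lemma l1_eq {a l : ℕ} (Z D : Matrix (Fin a) (Fin l) ℝ)
    (h : ∀ i j, Z i j ≠ 0 → |D i j| ≤ |Z i j|) :
    l1 (Z + D) = l1 Z + (finner D (msgn Z) + l1 (restrict D (cosuppSet Z))) := by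
  rw [sum_form]
  exact Finset.sum_congr rfl fun i _ => Finset.sum_congr rfl fun j _ => entry_eq _ _ (h i j)

lemma homog {a l : ℕ} (Z D : Matrix (Fin a) (Fin l) ℝ) (t : ℝ) (ht : 0 < t) :
    finner (t • D) (msgn Z) + l1 (restrict (t • D) (cosuppSet Z)) =
      t * (finner D (msgn Z) + l1 (restrict D (cosuppSet Z))) := by
  simp only [l1, finner, msgn, restrict, mul_add, Finset.mul_sum, Matrix.smul_apply, smul_eq_mul]
  congr 1
  · simp only [mul_assoc]
  · refine Finset.sum_congr rfl fun i _ => Finset.sum_congr rfl fun j _ => ?_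
    split_ifs
    · rw [abs_mul, abs_of_pos ht]
    · simp

lemma exists_small {a l : ℕ} (Z D : Matrix (Fin a) (Fin l) ℝ) :
    ∃ t : ℝ, 0 < t ∧ ∀ i j, Z i j ≠ 0 → |(t • D) i j| ≤ |Z i j| := by
  have h : ∀ᶠ t : ℝ in nhdsWithin 0 (Set.Ioi 0),
      ∀ i j, Z i j ≠ 0 → |(t • D) i j| ≤ |Z i j| := by
    refine Filter.eventually_all.2 fun i => Filter.eventually_all.2 fun j => ?_
    by_cases hz : Z i j = 0
    · simp [hz]
    · have hc : Filter.Tendsto (fun t : ℝ => |t * D i j|) (nhds 0) (nhds |0 * D i j|) :=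
        Continuous.tendsto (by fun_prop) 0
      have := hc.eventually_lt_const (u := |Z i j|) (by simpa using hz)
      filter_upwards [nhdsWithin_le_nhds this] with t ht _
      simpa using ht.le
  obtain ⟨t, h1, h2⟩ := (h.and self_mem_nhdsWithin).exists
  exact ⟨t, h2, h1⟩

/-- for a linear subspace T, Δ = 0 is the unique minimizer of
g(Δ) = ‖Z₀ + ΔX‖₁ over T iff ⟨ΔX, sgn(Z₀)⟩ + ‖(ΔX)_Λ̄‖₁ > 0 for every nonzero Δ ∈ T. -/
theorem stmt11 (a n l : ℕ) (ha : 0 < a) (hn : 0 < n) (hl : 0 < l)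
    (Z₀ : Matrix (Fin a) (Fin l) ℝ) (X : Matrix (Fin n) (Fin l) ℝ)
    (T : Submodule ℝ (Matrix (Fin a) (Fin n) ℝ)) :
    (∀ Δ ∈ T, Δ ≠ 0 → l1 (Z₀ + (0 : Matrix (Fin a) (Fin n) ℝ) * X) < l1 (Z₀ + Δ * X)) ↔
    (∀ Δ ∈ T, Δ ≠ 0 →
        0 < finner (Δ * X) (msgn Z₀) + l1 (restrict (Δ * X) (cosuppSet Z₀))) := by
  rw [Matrix.zero_mul, add_zero]
  constructor
  · intro H Δ hΔ h0
    obtain ⟨t, ht, hs⟩ := exists_small Z₀ (Δ * X)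
    have := H (t • Δ) (T.smul_mem t hΔ) (smul_ne_zero ht.ne' h0)
    rw [Matrix.smul_mul, l1_eq _ _ hs, homog _ _ _ ht] at this
    exact pos_of_mul_pos_right (by linarith) ht.le
  · intro H Δ hΔ h0
    have := H Δ hΔ h0
    have := l1_ge Z₀ (Δ * X)
    linarith
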